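/- For all n ≥ 0 and p, q ≥ 1, |GSCM_n(p,q)| = ∑_{a=0}^n C(a+(p+1)(q+1)−1, a)·C(n−a+pq−1, n−a), where |GSCM_n(p,q)| is the sum of the cardinalities of the four sets GSCM_n^{0,0}(p,q), GSCM_n^{1,0}(p,q), GSCM_n^{0,1}(p,q) and GSCM_n^{1,1}(p,q). -/

import Mathlib

/-- Generalized signed contingency matrices of type `(0,0)`: `p × q` matrices of signed numbers
`(a⁺, a⁻)` with total absolute value `n`. -/
def GSCM00 (n p q : ℕ) : Set (Matrix (Fin p) (Fin q) (ℕ × ℕ)) :=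
  {A | ∑ i, ∑ j, ((A i j).1 + (A i j).2) = n}

/-- Generalized signed contingency matrices of type `(1,0)`: `(p+1) × q` matrices of signed
numbers with total absolute value `n`, whose last row has vanishing negative parts and
positive total positive part. -/
def GSCM10 (n p q : ℕ) : Set (Matrix (Fin (p + 1)) (Fin q) (ℕ × ℕ)) :=
  {A | (∑ i, ∑ j, ((A i j).1 + (A i j).2) = n) ∧
       (∀ j, (A (Fin.last p) j).2 = 0) ∧ 0 < ∑ j, (A (Fin.last p) j).1}

/-- Generalized signed contingency matrices of type `(0,1)`: `p × (q+1)` matrices of signed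
numbers with total absolute value `n`, whose last column has vanishing negative parts and
positive total positive part. -/
def GSCM01 (n p q : ℕ) : Set (Matrix (Fin p) (Fin (q + 1)) (ℕ × ℕ)) :=
  {A | (∑ i, ∑ j, ((A i j).1 + (A i j).2) = n) ∧
       (∀ i, (A i (Fin.last q)).2 = 0) ∧ 0 < ∑ i, (A i (Fin.last q)).1}

/-- Generalized signed contingency matrices of type `(1,1)`: `(p+1) × (q+1)` matrices of signed
numbers with total absolute value `n`, whose last row and last column have vanishing negative
parts and positive total positive parts. -/
def GSCM11 (n p q : ℕ) : Set (Matrix (Fin (p + 1)) (Fin (q + 1)) (ℕ × ℕ)) :=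
  {A | (∑ i, ∑ j, ((A i j).1 + (A i j).2) = n) ∧
       (∀ j, (A (Fin.last p) j).2 = 0) ∧ (∀ i, (A i (Fin.last q)).2 = 0) ∧
       0 < ∑ j, (A (Fin.last p) j).1 ∧ 0 < ∑ i, (A i (Fin.last q)).1}

/-- `|GSCM_n(p,q)|`, the total number of generalized signed contingency matrices. -/
noncomputable def GSCMcard (n p q : ℕ) : ℕ :=
  Nat.card (GSCM00 n p q) + Nat.card (GSCM10 n p q) +
    Nat.card (GSCM01 n p q) + Nat.card (GSCM11 n p q)

/-- The extended matrices. -/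
def GX (n p q : ℕ) : Set (Matrix (Fin (p + 1)) (Fin (q + 1)) (ℕ × ℕ)) :=
  {A | (∑ i, ∑ j, ((A i j).1 + (A i j).2) = n) ∧
       (∀ j, (A (Fin.last p) j).2 = 0) ∧ (∀ i, (A i (Fin.last q)).2 = 0)}

/-- Pairs of nonnegative functions with total sum `n`. -/
def GT (n p q : ℕ) : Finset ((Fin (p + 1) × Fin (q + 1) → ℕ) × (Fin p × Fin q → ℕ)) :=
  (Finset.HasAntidiagonal.antidiagonal n).biUnion fun x =>
    Finset.piAntidiag Finset.univ x.1 ×ˢ Finset.piAntidiag Finset.univ x.2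

lemma mem_GT (n p q : ℕ) (x) : x ∈ GT n p q ↔ ∑ i, x.1 i + ∑ i, x.2 i = n := by
  simp [GT]

lemma card_piAnti (ι : Type) [Fintype ι] [DecidableEq ι] [Nonempty ι] (n : ℕ) :
    (Finset.piAntidiag (Finset.univ : Finset ι) n).card
      = (n + Fintype.card ι - 1).choose n := by
  have h := Finset.map_sym_eq_piAntidiag (Finset.univ : Finset ι) n
  rw [← h, Finset.card_map, Finset.sym_univ, Finset.card_univ, Sym.card_sym_eq_choose, add_comm]

lemma card_GT (n p q : ℕ) (hp : 1 ≤ p) (hq : 1 ≤ q) : (GT n p q).card =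
      ∑ a ∈ Finset.range (n + 1),
        (a + (p + 1) * (q + 1) - 1).choose a * (n - a + p * q - 1).choose (n - a) := by
  have : Nonempty (Fin p × Fin q) := ⟨(⟨0, hp⟩, ⟨0, hq⟩)⟩
  rw [GT, Finset.card_biUnion]
  · simp only [Finset.card_product, card_piAnti, Fintype.card_prod, Fintype.card_fin]
    rw [Finset.Nat.sum_antidiagonal_eq_sum_range_succ_mk]
  · intro x _ y _ hxy
    refine Finset.disjoint_left.2 ?_
    intro z hz hz'
    simp at hz hz'
    exact hxy (Prod.ext (hz.1.symm.trans hz'.1) (hz.2.symm.trans hz'.2))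

/-- Extended matrices as pairs. -/
def GXequiv (n p q : ℕ) : GX n p q ≃ GT n p q where
  toFun A := ⟨(fun x => (A.1 x.1 x.2).1, fun x => (A.1 x.1.castSucc x.2.castSucc).2), by
    obtain ⟨A, h1, h2, h3⟩ := A
    rw [mem_GT]
    simp only [Finset.sum_add_distrib] at h1
    rw [Fin.sum_univ_castSucc (f := fun i => ∑ j, (A i j).2)] at h1
    simp only [h2, Fin.sum_univ_castSucc (f := fun j => (A _ j).2), h3] at h1
    simpa [Fintype.sum_prod_type] using h1⟩
  invFun x := ⟨fun i j => (x.1.1 (i, j),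
      Fin.lastCases (motive := fun _ => ℕ) 0 (fun i' =>
        Fin.lastCases (motive := fun _ => ℕ) 0 (fun j' => x.1.2 (i', j')) j) i), by
    obtain ⟨x, hx⟩ := x
    rw [mem_GT] at hx
    refine ⟨?_, ?_, ?_⟩
    · simp only [Finset.sum_add_distrib]
      rw [← hx, Fintype.sum_prod_type, Fintype.sum_prod_type]
      congr 1
      simp [Fin.sum_univ_castSucc]
    · simp
    · intro i
      induction i using Fin.lastCases <;> simp⟩
  left_inv A := by
    obtain ⟨A, h1, h2, h3⟩ := A
    ext i j
    · rfl
    · induction i using Fin.lastCases with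
      | last => simp [h2]
      | cast i =>
        induction j using Fin.lastCases with
        | last => simp [h3]
        | cast j => simp
  right_inv x := by
    ext y <;> simp

/-- Row vanishing. -/
def RowP {p q : ℕ} (A : Matrix (Fin (p + 1)) (Fin (q + 1)) (ℕ × ℕ)) : Prop :=
  0 < ∑ j, (A (Fin.last p) j).1

/-- Column vanishing. -/
def ColP {p q : ℕ} (A : Matrix (Fin (p + 1)) (Fin (q + 1)) (ℕ × ℕ)) : Prop :=
  0 < ∑ i, (A i (Fin.last q)).1

/-- Append a zero row. -/
def addRow {p q : ℕ} (A : Matrix (Fin p) (Fin q) (ℕ × ℕ)) :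
    Matrix (Fin (p + 1)) (Fin q) (ℕ × ℕ) :=
  fun i j => Fin.lastCases (motive := fun _ => ℕ × ℕ) 0 (fun i' => A i' j) i

/-- Append a zero column. -/
def addCol {p q : ℕ} (A : Matrix (Fin p) (Fin q) (ℕ × ℕ)) :
    Matrix (Fin p) (Fin (q + 1)) (ℕ × ℕ) :=
  fun i j => Fin.lastCases (motive := fun _ => ℕ × ℕ) 0 (fun j' => A i j') j

@[simp] lemma addRow_last {p q : ℕ} (A : Matrix (Fin p) (Fin q) (ℕ × ℕ)) (j) :
    addRow A (Fin.last p) j = 0 := by simp [addRow]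
@[simp] lemma addRow_cast {p q : ℕ} (A : Matrix (Fin p) (Fin q) (ℕ × ℕ)) (i j) :
    addRow A (Fin.castSucc i) j = A i j := by simp [addRow]
@[simp] lemma addCol_last {p q : ℕ} (A : Matrix (Fin p) (Fin q) (ℕ × ℕ)) (i) :
    addCol A i (Fin.last q) = 0 := by simp [addCol]
@[simp] lemma addCol_cast {p q : ℕ} (A : Matrix (Fin p) (Fin q) (ℕ × ℕ)) (i j) :
    addCol A i (Fin.castSucc j) = A i j := by simp [addCol]

lemma addRow_inj {p q : ℕ} : Function.Injective (addRow (p := p) (q := q)) := by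
  intro A B h
  ext1 i j
  simpa using congrFun (congrFun h i.castSucc) j

lemma addCol_inj {p q : ℕ} : Function.Injective (addCol (p := p) (q := q)) := by
  intro A B h
  ext1 i j
  simpa using congrFun (congrFun h i) j.castSucc

lemma eq_addRow {p q : ℕ} (A : Matrix (Fin (p + 1)) (Fin q) (ℕ × ℕ))
    (h : ∀ j, A (Fin.last p) j = 0) : addRow (fun i j => A i.castSucc j) = A := by
  ext1 i j
  induction i using Fin.lastCases with
  | last => exact (addRow_last _ _).trans (h j).symm
  | cast i => exact addRow_cast _ _ _

lemma eq_addCol {p q : ℕ} (A : Matrix (Fin p) (Fin (q + 1)) (ℕ × ℕ))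
    (h : ∀ i, A i (Fin.last q) = 0) : addCol (fun i j => A i j.castSucc) = A := by
  ext1 i j
  induction j using Fin.lastCases with
  | last => exact (addCol_last _ _).trans (h i).symm
  | cast j => exact addCol_cast _ _ _

lemma row_zero {n p q : ℕ} {A} (hA : A ∈ GX n p q) (h : ¬ RowP A) (j) :
    A (Fin.last p) j = 0 := by
  have h' : ∑ j, (A (Fin.last p) j).1 = 0 := by unfold RowP at h; omega
  rw [Finset.sum_eq_zero_iff] at h'
  exact Prod.ext (h' j (Finset.mem_univ _)) (hA.2.1 j)

lemma col_zero {n p q : ℕ} {A} (hA : A ∈ GX n p q) (h : ¬ ColP A) (i) :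
    A i (Fin.last q) = 0 := by
  have h' : ∑ i, (A i (Fin.last q)).1 = 0 := by unfold ColP at h; omega
  rw [Finset.sum_eq_zero_iff] at h'
  exact Prod.ext (h' i (Finset.mem_univ _)) (hA.2.2 i)

lemma img10 (n p q : ℕ) : addCol '' GSCM10 n p q = {A ∈ GX n p q | RowP A ∧ ¬ ColP A} := by
  ext A
  constructor
  · rintro ⟨A, ⟨h1, h2, h3⟩, rfl⟩
    refine ⟨⟨?_, ?_, ?_⟩, ?_, ?_⟩
    · simpa [Fin.sum_univ_castSucc (n := q)] using h1
    · intro j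
      induction j using Fin.lastCases <;> simp [h2]
    · simp
    · simpa [RowP, Fin.sum_univ_castSucc (n := q)] using h3
    · simp [ColP]
  · rintro ⟨hA, hr, hc⟩
    have hz := col_zero hA hc
    refine ⟨_, ⟨?_, ?_, ?_⟩, eq_addCol A hz⟩
    · simpa [Fin.sum_univ_castSucc (n := q), hz] using hA.1
    · intro j; exact hA.2.1 _
    · simpa [RowP, Fin.sum_univ_castSucc (n := q), hz] using hr

lemma img01 (n p q : ℕ) : addRow '' GSCM01 n p q = {A ∈ GX n p q | ¬ RowP A ∧ ColP A} := by
  ext A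
  constructor
  · rintro ⟨A, ⟨h1, h2, h3⟩, rfl⟩
    refine ⟨⟨?_, ?_, ?_⟩, ?_, ?_⟩
    · rw [Fin.sum_univ_castSucc]; simpa using h1
    · simp
    · intro j
      induction j using Fin.lastCases <;> simp [h2]
    · simp [RowP]
    · unfold ColP; rw [Fin.sum_univ_castSucc]; simpa using h3
  · rintro ⟨hA, hr, hc⟩
    have hz := row_zero hA hr
    refine ⟨_, ⟨?_, ?_, ?_⟩, eq_addRow A hz⟩
    · have := hA.1
      rw [Fin.sum_univ_castSucc] at this; simpa [hz] using this
    · intro j; exact hA.2.2 _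
    · unfold ColP at hc; rw [Fin.sum_univ_castSucc] at hc; simpa [hz] using hc

lemma img00 (n p q : ℕ) : (fun A => addRow (addCol A)) '' GSCM00 n p q
    = {A ∈ GX n p q | ¬ RowP A ∧ ¬ ColP A} := by
  ext A
  constructor
  · rintro ⟨A, h1, rfl⟩
    replace h1 : ∑ i, ∑ j, ((A i j).1 + (A i j).2) = n := h1
    refine ⟨⟨?_, ?_, ?_⟩, ?_, ?_⟩
    · rw [Fin.sum_univ_castSucc]
      simpa [Fin.sum_univ_castSucc (n := q)] using h1
    · simp
    · intro j
      induction j using Fin.lastCases <;> simp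
    · simp [RowP]
    · unfold ColP; rw [Fin.sum_univ_castSucc]; simp
  · rintro ⟨hA, hr, hc⟩
    have hz := row_zero hA hr
    have hz' := col_zero hA hc
    refine ⟨fun i j => A i.castSucc j.castSucc, ?_, ?_⟩
    · have := hA.1
      rw [Fin.sum_univ_castSucc] at this
      change ∑ i : Fin p, ∑ j : Fin q, ((A i.castSucc j.castSucc).1 + (A i.castSucc j.castSucc).2) = n
      simpa [Fin.sum_univ_castSucc (n := q), hz, hz'] using this
    · change addRow (addCol _) = A
      rw [eq_addCol (fun i j => A i.castSucc j) (fun i => hz' _), eq_addRow A hz]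

lemma img11 (n p q : ℕ) : GSCM11 n p q = {A ∈ GX n p q | RowP A ∧ ColP A} := by
  ext A
  simp only [GSCM11, GX, RowP, ColP, Set.mem_ofPred_eq]
  tauto

lemma ncard_split {α : Type} (s : Set α) (hs : s.Finite) (P : α → Prop) :
    {a ∈ s | P a}.ncard + {a ∈ s | ¬ P a}.ncard = s.ncard := by
  rw [← Set.ncard_union_eq _ (hs.subset (Set.sep_subset _ _)) (hs.subset (Set.sep_subset _ _))]
  · congr 1
    ext a
    simp only [Set.mem_union, Set.mem_ofPred_eq]
    tauto
  · rw [Set.disjoint_left]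
    exact fun a h h' => h'.2 h.2

/-- `|GSCM_n(p,q)| = ∑_{a=0}^n C(a + (p+1)(q+1) − 1, a) · C(n − a + pq − 1, n − a)`. -/
theorem card_GSCM (n p q : ℕ) (hp : 1 ≤ p) (hq : 1 ≤ q) :
    GSCMcard n p q =
      ∑ a ∈ Finset.range (n + 1),
        (a + (p + 1) * (q + 1) - 1).choose a * (n - a + p * q - 1).choose (n - a) := by
  rw [← card_GT n p q hp hq]
  have hX : (GX n p q).ncard = (GT n p q).card := by
    rw [← Nat.card_coe_set_eq, Nat.card_congr (GXequiv n p q)]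
    simp
  have hfin : (GX n p q).Finite := @Set.toFinite _ _ (Finite.of_equiv _ (GXequiv n p q).symm)
  rw [← hX, GSCMcard]
  simp only [Nat.card_coe_set_eq]
  rw [← Set.ncard_image_of_injective (GSCM00 n p q)
      (f := fun A => addRow (addCol A)) (addRow_inj.comp addCol_inj),
    ← Set.ncard_image_of_injective (GSCM10 n p q) addCol_inj,
    ← Set.ncard_image_of_injective (GSCM01 n p q) addRow_inj, img00, img10, img01, img11]
  have e1 := ncard_split _ hfin RowP
  have e2 := ncard_split _ (hfin.subset (Set.sep_subset _ RowP)) ColP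
  have e3 := ncard_split _ (hfin.subset (Set.sep_subset _ fun A => ¬ RowP A)) ColP
  simp only [Set.mem_ofPred_eq, and_assoc] at e2 e3
  omega
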